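/- Let φ : ℝ³ → Mat₃(ℝ) be a smooth field of symmetric matrices (φₗₙ = φₙₗ) and define σᵢⱼ = ∑_{k,l,m,n} εᵢₖₗ·εⱼₘₙ·∂ₖ∂ₘφₗₙ, where ε is the Levi-Civita symbol on three indices. Then σ is symmetric (σᵢⱼ = σⱼᵢ) and satisfies the Cauchy equations ∑ⱼ ∂ⱼσᵢⱼ = 0 for i = 1, 2, 3. -/

import Mathlib

/-- Partial derivative in the `i`-th coordinate direction on `ℝ³`. -/
noncomputable def pd (i : Fin 3)
    (f : EuclideanSpace ℝ (Fin 3) → ℝ) (x : EuclideanSpace ℝ (Fin 3)) : ℝ :=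
  fderiv ℝ f x (EuclideanSpace.single i 1)

/-- The Levi-Civita symbol on three indices, with `eps 0 1 2 = 1`. -/
noncomputable def eps (i j k : Fin 3) : ℝ :=
  (((j : ℤ) - (i : ℤ)) * ((k : ℤ) - (j : ℤ)) * ((k : ℤ) - (i : ℤ)) : ℤ) / 2

open scoped ContDiff in
theorem ContDiff.pd {f : EuclideanSpace ℝ (Fin 3) → ℝ} (hf : ContDiff ℝ ∞ f) (i : Fin 3) :
    ContDiff ℝ ∞ (pd i f) :=
  (hf.fderiv_right (m := ∞) (by simp)).clm_apply contDiff_const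

open scoped ContDiff in
theorem pd_comm {f : EuclideanSpace ℝ (Fin 3) → ℝ} (hf : ContDiff ℝ ∞ f) (i j : Fin 3) :
    pd i (pd j f) = pd j (pd i f) := by
  have pd_pd (i j : Fin 3) (x : EuclideanSpace ℝ (Fin 3)) : pd i (pd j f) x =
      fderiv ℝ (fderiv ℝ f) x (EuclideanSpace.single i 1) (EuclideanSpace.single j 1) := by
    have h : DifferentiableAt ℝ (fderiv ℝ f) x :=
      ((hf.fderiv_right (m := ∞) (by simp)).differentiable (by simp)).differentiableAt
    unfold pd
    rw [fderiv_clm_apply h (differentiableAt_const _)]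
    simp
  funext x
  rw [pd_pd, pd_pd]
  have h2 : (2 : WithTop ℕ∞) ≤ ∞ := WithTop.coe_le_coe.2 (le_top (a := (2 : ℕ∞)))
  exact (hf.contDiffAt.isSymmSndFDerivAt (by simpa using h2)).eq _ _

theorem pd_sum {ι : Type*} (s : Finset ι) {f : ι → EuclideanSpace ℝ (Fin 3) → ℝ}
    (hf : ∀ a ∈ s, Differentiable ℝ (f a)) (i : Fin 3) (x : EuclideanSpace ℝ (Fin 3)) :
    pd i (fun y => ∑ a ∈ s, f a y) x = ∑ a ∈ s, pd i (f a) x := by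
  simp [pd, fderiv_fun_sum fun a ha => (hf a ha).differentiableAt]

theorem pd_const_mul {f : EuclideanSpace ℝ (Fin 3) → ℝ} (hf : Differentiable ℝ f) (c : ℝ)
    (i : Fin 3) (x : EuclideanSpace ℝ (Fin 3)) :
    pd i (fun y => c * f y) x = c * pd i f x := by
  simp [pd, fderiv_const_mul hf.differentiableAt]

theorem eps_swap_left (i j k : Fin 3) : eps j i k = -eps i j k := by
  simp only [eps]
  push_cast
  ring

/-- Contracting the Levi-Civita symbol with a symmetric pair of indices gives zero. -/
theorem sum_eps_mul_eq_zero (T : Fin 3 → Fin 3 → Fin 3 → ℝ)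
    (hT : ∀ j m p, T j m p = T m j p) :
    ∑ j, ∑ m, ∑ p, eps j m p * T j m p = 0 := by
  have h : ∑ j, ∑ m, ∑ p, eps j m p * T j m p = -∑ j, ∑ m, ∑ p, eps j m p * T j m p := by
    conv_lhs => rw [Finset.sum_comm]
    simp only [← Finset.sum_neg_distrib]
    refine Finset.sum_congr rfl fun j _ => Finset.sum_congr rfl fun m _ =>
      Finset.sum_congr rfl fun p _ => ?_
    rw [eps_swap_left j m, hT m j, neg_mul]
  linarith

/-- The Beltrami parametrization (1892): the double curl of a smooth symmetric
potential `φ` is a symmetric stress field satisfying the Cauchy equations. -/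
theorem beltrami_parametrizes_cauchy
    (φ : EuclideanSpace ℝ (Fin 3) → Fin 3 → Fin 3 → ℝ)
    (hφ : ContDiff ℝ (⊤ : ℕ∞) φ)
    (hφsym : ∀ x l m, φ x l m = φ x m l)
    (σ : EuclideanSpace ℝ (Fin 3) → Fin 3 → Fin 3 → ℝ)
    (hσ : σ = fun x i j => ∑ k : Fin 3, ∑ l : Fin 3, ∑ m : Fin 3, ∑ p : Fin 3,
      eps i k l * eps j m p * pd k (pd m (fun y => φ y l p)) x) :
    (∀ x i j, σ x i j = σ x j i) ∧
    (∀ x i, ∑ j : Fin 3, pd j (fun y => σ y i j) x = 0) := by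
  have hφ' (l p : Fin 3) : ContDiff ℝ (⊤ : ℕ∞) (fun y => φ y l p) :=
    contDiff_pi.1 (contDiff_pi.1 hφ l) p
  have hd (k m l p : Fin 3) : Differentiable ℝ (pd k (pd m fun y => φ y l p)) :=
    (((hφ' l p).pd m).pd k).differentiable (by simp)
  subst hσ
  refine ⟨fun x i j => ?_, fun x i => ?_⟩
  · have hterm (k l m p : Fin 3) :
        eps i k l * eps j m p * pd k (pd m fun y => φ y l p) x =
          eps j m p * eps i k l * pd m (pd k fun y => φ y p l) x := by
      rw [pd_comm (hφ' l p), mul_comm (eps i k l)]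
      simp only [hφsym _ l p]
    simp only [hterm, ← Fintype.sum_prod_type']
    let e : Fin 3 × Fin 3 × Fin 3 × Fin 3 ≃ Fin 3 × Fin 3 × Fin 3 × Fin 3 :=
      ⟨fun a => (a.2.2.1, a.2.2.2, a.1, a.2.1), fun a => (a.2.2.1, a.2.2.2, a.1, a.2.1),
        fun _ => rfl, fun _ => rfl⟩
    exact Fintype.sum_equiv e _ _ fun _ => rfl
  · have hpd (j : Fin 3) :
        pd j (fun y => ∑ k : Fin 3, ∑ l : Fin 3, ∑ m : Fin 3, ∑ p : Fin 3,
          eps i k l * eps j m p * pd k (pd m fun y => φ y l p) y) x =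
        ∑ k : Fin 3, ∑ l : Fin 3, ∑ m : Fin 3, ∑ p : Fin 3,
          eps i k l * eps j m p * pd j (pd k (pd m fun y => φ y l p)) x := by
      have hm (k l m p : Fin 3) : Differentiable ℝ
          fun y => eps i k l * eps j m p * pd k (pd m fun y => φ y l p) y :=
        (hd k m l p).const_mul _
      rw [pd_sum _ (by fun_prop)]
      refine Finset.sum_congr rfl fun k _ => ?_
      rw [pd_sum _ (by fun_prop)]
      refine Finset.sum_congr rfl fun l _ => ?_
      rw [pd_sum _ (by fun_prop)]
      refine Finset.sum_congr rfl fun m _ => ?_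
      rw [pd_sum _ (by fun_prop)]
      exact Finset.sum_congr rfl fun p _ => pd_const_mul (hd k m l p) _ j x
    simp only [hpd]
    rw [Finset.sum_comm]
    refine Finset.sum_eq_zero fun k _ => ?_
    rw [Finset.sum_comm]
    refine Finset.sum_eq_zero fun l _ => ?_
    simp only [mul_assoc, ← Finset.mul_sum]
    rw [sum_eps_mul_eq_zero _ fun j m p => ?_, mul_zero]
    rw [pd_comm (hφ' l p) k m, pd_comm ((hφ' l p).pd k) j m, pd_comm (hφ' l p) j k]
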